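/- Let d ≥ 4 be an even integer enerate. Let y > 0 and let x be a real number with |x| ≤ 1/2 and y < 2π|x| (so that the argument of τ = y + 2πi x exceeds π/4 in absolute value). Define c_2 = min(B1, B2, B3, B4), where B1 = 2π(1 − cos(2π/(d+5)))(e^{(2d+4)π} + e^{(d+5)π}) / ((e^{(d+3)π} − 1)(e^{(d+3)π} + 1)^2), B2 = π(1 − cos(2π/(d+5)))(e^{(3d+7)π} + e^{2π} − e^{(2d+4)π} − e^{(d+5)π}) / ((e^{(d+3)π} − 1)(e^{(d+3)π} + 1)^2), B3 = 2π(1 − cos((d+3−π)/(d+3)^2))(d+3)(d+1) / ((e^{π(d+3)} − 1)(8π^2 + (d+3)^2)), and B4 = 8π / ((e^{(d+3)π} − 1)((e^{(d+3)/2} − 1)^2 + 4 e^{(d+3)/2})). Then Re(g_d(y + 2πi x)) − g_d(y) ≤ −c_2 / y. -/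

import Mathlib

open Real Complex

/-- g_d(τ) = Σ e^{−nτ}, summed over integers n ≥ 0 with n ≡ ±2 (mod d+3). -/
noncomputable def gFun (d : ℕ) (τ : ℂ) : ℂ :=
  ∑' n : ℕ, if (n : ZMod (d + 3)) = 2 ∨ (n : ZMod (d + 3)) = -2 then
    Complex.exp (-(n : ℂ) * τ) else 0

/-- The common denominator D(x,y). -/
noncomputable def Dden (d : ℕ) (x y : ℝ) : ℝ :=
  ((Real.exp (((d : ℝ) + 3) * y) - 1) / y) *
    (Real.exp (2 * ((d : ℝ) + 3) * y) -
      2 * Real.exp (((d : ℝ) + 3) * y) * Real.cos (2 * π * ((d : ℝ) + 3) * x) + 1)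

noncomputable def T1 (d : ℕ) (x y : ℝ) : ℝ :=
  (1 - Real.cos (4 * π * x)) *
    (Real.exp ((3 * (d : ℝ) + 7) * y) + Real.exp (2 * y) -
      Real.exp ((2 * (d : ℝ) + 4) * y) - Real.exp (((d : ℝ) + 5) * y)) / Dden d x y

noncomputable def T2 (d : ℕ) (x y : ℝ) : ℝ :=
  (1 - Real.cos (2 * π * ((d : ℝ) + 1) * x)) *
    (Real.exp ((2 * (d : ℝ) + 8) * y) + Real.exp (((d : ℝ) + 1) * y) -
      Real.exp ((2 * (d : ℝ) + 4) * y) - Real.exp (((d : ℝ) + 5) * y)) / Dden d x y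

noncomputable def T3 (d : ℕ) (x y : ℝ) : ℝ :=
  2 * (1 - Real.cos (2 * π * ((d : ℝ) + 3) * x)) *
    (Real.exp ((2 * (d : ℝ) + 4) * y) + Real.exp (((d : ℝ) + 5) * y)) / Dden d x y

theorem hasSum_ite_natCast_zmod_eq {m r : ℕ} (hr : r < m) {z : ℂ} (hz : ‖z‖ < 1) :
    HasSum (fun n : ℕ => if (n : ZMod m) = (r : ZMod m) then z ^ n else 0)
      (z ^ r / (1 - z ^ m)) := by
  have hm : 0 < m := by omega
  have hinj : Function.Injective (fun k : ℕ => r + m * k) := fun a b h => by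
    have h' : r + m * a = r + m * b := h
    exact Nat.eq_of_mul_eq_mul_left hm (by omega)
  rw [← hinj.hasSum_iff]
  · have hzm : ‖z ^ m‖ < 1 := by
      rw [norm_pow]; exact pow_lt_one₀ (norm_nonneg _) hz hm.ne'
    have h := (hasSum_geometric_of_norm_lt_one hzm).mul_left (z ^ r)
    rw [div_eq_mul_inv]
    refine h.congr_fun ?_
    intro k
    simp [pow_add, pow_mul]
  · intro n hn
    rw [if_neg]
    intro h
    rw [ZMod.natCast_eq_natCast_iff] at h
    have h1 : n % m = r := by rw [h, Nat.mod_eq_of_lt hr]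
    exact hn ⟨n / m, by simp only [← h1]; exact Nat.mod_add_div n m⟩

theorem gFun_eq_div (d : ℕ) (hd : 4 ≤ d) {τ : ℂ} (hτ : 0 < τ.re) :
    gFun d τ = (cexp (-(2 * τ)) + cexp (-((d + 1) * τ))) / (1 - cexp (-((d + 3) * τ))) := by
  have hz : ‖cexp (-τ)‖ < 1 := by
    rw [Complex.norm_exp, Real.exp_lt_one_iff]; simpa using hτ
  have h := (hasSum_ite_natCast_zmod_eq (m := d + 3) (r := 2) (by omega) hz).add
    (hasSum_ite_natCast_zmod_eq (m := d + 3) (r := d + 1) (by omega) hz)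
  have hneg : ((d + 1 : ℕ) : ZMod (d + 3)) = -2 := by
    have h0 : ((d + 3 : ℕ) : ZMod (d + 3)) = 0 := ZMod.natCast_self _
    push_cast at h0 ⊢
    linear_combination h0
  have hne : ((2 : ℕ) : ZMod (d + 3)) ≠ ((d + 1 : ℕ) : ZMod (d + 3)) := by
    rw [Ne, ZMod.natCast_eq_natCast_iff, Nat.ModEq, Nat.mod_eq_of_lt (by omega),
      Nat.mod_eq_of_lt (by omega)]
    omega
  have hpow : ∀ n : ℕ, cexp (-τ) ^ n = cexp (-(n * τ)) := fun n => by
    rw [← Complex.exp_nat_mul]; ring_nf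
  rw [← add_div] at h
  have hsum := h.tsum_eq
  have hg : gFun d τ = ∑' n : ℕ, ((if (n : ZMod (d + 3)) = ((2 : ℕ) : ZMod (d + 3)) then
      cexp (-τ) ^ n else 0) + if (n : ZMod (d + 3)) = ((d + 1 : ℕ) : ZMod (d + 3)) then
      cexp (-τ) ^ n else 0) := by
    unfold gFun
    refine tsum_congr fun n => ?_
    rw [hpow, ← hneg, neg_mul]
    by_cases h1 : (n : ZMod (d + 3)) = 2
    · have h2 : (n : ZMod (d + 3)) ≠ ((d + 1 : ℕ) : ZMod (d + 3)) := by
        rw [h1]; exact_mod_cast hne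
      simp only [h1, true_or, if_true]
      rw [if_pos (by norm_cast), if_neg (by rw [← h1]; exact h2), add_zero]
    · rw [if_neg (c := (n : ZMod (d + 3)) = ((2 : ℕ) : ZMod (d + 3))) (by exact_mod_cast h1)]
      simp [h1]
  rw [hg, hsum, hpow, hpow, hpow]
  push_cast
  rfl

theorem re_exp_add_exp_div_one_sub_exp (a b y t : ℝ) :
    ((cexp (-(a * (y + t * I))) + cexp (-(b * (y + t * I)))) /
      (1 - cexp (-((a + b) * (y + t * I))))).re =
    (rexp (-(a * y)) * (Real.cos (a * t) - rexp (-((a + b) * y)) * Real.cos (b * t)) +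
      rexp (-(b * y)) * (Real.cos (b * t) - rexp (-((a + b) * y)) * Real.cos (a * t))) /
      (1 - 2 * rexp (-((a + b) * y)) * Real.cos ((a + b) * t) + rexp (-((a + b) * y)) ^ 2) := by
  have hre : ∀ c : ℝ, (cexp (-(c * (y + t * I)))).re = rexp (-(c * y)) * Real.cos (c * t) := by
    intro c; simp [Complex.exp_re]
  have him : ∀ c : ℝ, (cexp (-(c * (y + t * I)))).im = -(rexp (-(c * y)) * Real.sin (c * t)) := by
    intro c; simp [Complex.exp_im]
  rw [← Complex.ofReal_add, Complex.div_re, ← add_div]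
  simp only [Complex.add_re, Complex.add_im, Complex.sub_re, Complex.sub_im, Complex.one_re,
    Complex.one_im, hre, him, Complex.normSq_apply]
  have hcos : Real.cos ((a + b) * t) =
      Real.cos (a * t) * Real.cos (b * t) - Real.sin (a * t) * Real.sin (b * t) := by
    rw [add_mul, Real.cos_add]
  have hsin : Real.sin ((a + b) * t) =
      Real.sin (a * t) * Real.cos (b * t) + Real.cos (a * t) * Real.sin (b * t) := by
    rw [add_mul, Real.sin_add]
  congr 1
  · rw [hcos, hsin]
    have ha := Real.sin_sq_add_cos_sq (a * t)
    have hb := Real.sin_sq_add_cos_sq (b * t)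
    set q := rexp (-((a + b) * y))
    set p := rexp (-(a * y))
    set p' := rexp (-(b * y))
    linear_combination (-q * p * Real.cos (b * t)) * ha - q * p' * Real.cos (a * t) * hb
  · linear_combination rexp (-((a + b) * y)) ^ 2 * Real.sin_sq_add_cos_sq ((a + b) * t)

/-- The closed form of `g_d(y) - Re g_d(y + it)` as a quotient of manifestly nonnegative terms. -/
theorem gFun_re_sub_gFun_re (d : ℕ) (hd : 4 ≤ d) {y : ℝ} (hy : 0 < y) (t : ℝ) :
    (gFun d y).re - (gFun d (y + t * I)).re =
      (2 * rexp (-((d + 3) * y)) * (1 - Real.cos ((d + 3) * t)) *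
          (rexp (-(2 * y)) + rexp (-((d + 1) * y))) +
        (1 - rexp (-((d + 3) * y))) *
          ((rexp (-(2 * y)) - rexp (-((d + 3) * y)) * rexp (-((d + 1) * y))) *
              (1 - Real.cos (2 * t)) +
            (rexp (-((d + 1) * y)) - rexp (-((d + 3) * y)) * rexp (-(2 * y))) *
              (1 - Real.cos ((d + 1) * t)))) /
      ((1 - rexp (-((d + 3) * y))) * ((1 - rexp (-((d + 3) * y))) ^ 2 +
        2 * rexp (-((d + 3) * y)) * (1 - Real.cos ((d + 3) * t)))) := by
  have key : ∀ s : ℝ, (gFun d (y + s * I)).re =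
      (rexp (-(2 * y)) *
          (Real.cos (2 * s) - rexp (-((d + 3) * y)) * Real.cos ((d + 1) * s)) +
        rexp (-((d + 1) * y)) *
          (Real.cos ((d + 1) * s) - rexp (-((d + 3) * y)) * Real.cos (2 * s))) /
      (1 - 2 * rexp (-((d + 3) * y)) * Real.cos ((d + 3) * s) +
        rexp (-((d + 3) * y)) ^ 2) := fun s => by
    rw [gFun_eq_div d hd (τ := y + s * I) (by simpa using hy)]
    have h := re_exp_add_exp_div_one_sub_exp 2 (d + 1) y s
    rw [show (2 : ℝ) + (d + 1) = d + 3 by ring] at h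
    push_cast at h
    rw [show (2 : ℂ) + (d + 1) = d + 3 by ring] at h
    exact h
  have h0 := key 0
  simp only [Complex.ofReal_zero, zero_mul, add_zero, mul_zero, Real.cos_zero, mul_one] at h0
  rw [h0, key t]
  have hq : rexp (-((d + 3) * y)) < 1 := by rw [Real.exp_lt_one_iff]; simp; positivity
  have hq0 := Real.exp_pos (-((d + 3) * y))
  have hc := Real.cos_le_one ((d + 3) * t)
  set q := rexp (-((d + 3) * y))
  have e1 : 1 - 2 * q + q ^ 2 = (1 - q) ^ 2 := by ring
  have e2 : 1 - 2 * q * Real.cos ((d + 3) * t) + q ^ 2 =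
      (1 - q) ^ 2 + 2 * q * (1 - Real.cos ((d + 3) * t)) := by ring
  have hs : 1 - q ≠ 0 := by linarith
  have hden : (1 - q) ^ 2 + 2 * q * (1 - Real.cos ((d + 3) * t)) ≠ 0 := by
    have : 0 < (1 - q) ^ 2 := by positivity
    have : 0 ≤ 2 * q * (1 - Real.cos ((d + 3) * t)) :=
      mul_nonneg (by positivity) (by linarith)
    linarith
  rw [e1, e2]
  generalize Real.cos ((d + 3) * t) = c at hden ⊢
  generalize rexp (-((d + 1) * y)) = p'
  generalize hD : (1 - q) ^ 2 + 2 * q * (1 - c) = D at hden ⊢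
  field_simp
  rw [← hD]
  ring

theorem div_mul_one_sub_exp_le {a m : ℝ} (ha : 0 ≤ a) (ham : a ≤ m) (hm : 0 < m) (y : ℝ) :
    a / m * (1 - rexp (-(m * y))) ≤ 1 - rexp (-(a * y)) := by
  have h := rpow_one_add_le_one_add_mul_self (s := rexp (-(m * y)) - 1)
    (by linarith [Real.exp_pos (-(m * y))]) (div_nonneg ha hm.le) ((div_le_one hm).2 ham)
  rw [add_sub_cancel, ← Real.exp_mul,
    show -(m * y) * (a / m) = -(a * y) by field_simp] at h
  linarith

/-- A lower bound for `g_d(y) - Re g_d(y + it)` in terms of weighted averages. -/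
theorem div_le_gFun_re_sub_gFun_re (d : ℕ) (hd : 4 ≤ d) {y t κ : ℝ} (hy : 0 < y) (hκ : 0 ≤ κ)
    (h : κ * ((1 - rexp (-((d + 3) * y))) ^ 2 +
          2 * rexp (-((d + 3) * y)) * (1 - Real.cos ((d + 3) * t))) ≤
      2 * rexp (-((d + 3) * y)) * (1 - Real.cos ((d + 3) * t)) *
          (rexp (-(2 * y)) + rexp (-((d + 1) * y))) +
        (1 - rexp (-((d + 3) * y))) ^ 2 *
          (rexp (-(2 * y)) * (1 - Real.cos (2 * t)) +
            4 / (d + 3) * rexp (-((d + 1) * y)) * (1 - Real.cos ((d + 1) * t)))) :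
    κ / ((d + 3) * y) ≤ (gFun d y).re - (gFun d (y + t * I)).re := by
  rw [gFun_re_sub_gFun_re d hd hy t]
  have hd' : (4 : ℝ) ≤ d := by exact_mod_cast hd
  have hq : rexp (-((d + 3) * y)) < 1 := by rw [Real.exp_lt_one_iff]; simp; positivity
  have hq0 := Real.exp_pos (-((d + 3) * y))
  have hsm : 1 - rexp (-((d + 3) * y)) ≤ (d + 3) * y := by
    linarith [Real.add_one_le_exp (-((d + 3) * y))]
  have hp : rexp (-((d + 1) * y)) ≤ rexp (-(2 * y)) := by
    rw [Real.exp_le_exp]; nlinarith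
  have h4 := mul_le_mul_of_nonneg_left
    (div_mul_one_sub_exp_le (a := 4) (m := d + 3) (by norm_num) (by linarith) (by linarith) y)
    (Real.exp_pos (-((d + 1) * y))).le
  have hmul : rexp (-((d + 3) * y)) * rexp (-(2 * y)) =
      rexp (-((d + 1) * y)) * rexp (-(4 * y)) := by
    rw [← Real.exp_add, ← Real.exp_add]; ring_nf
  have hc := Real.cos_le_one ((d + 3) * t)
  have hA := Real.cos_le_one (2 * t)
  have hA' := Real.cos_le_one ((d + 1) * t)
  rw [hmul]
  set q := rexp (-((d + 3) * y))
  set p := rexp (-(2 * y))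
  set p' := rexp (-((d + 1) * y))
  have hs : 0 < 1 - q := by linarith
  have hw : 0 ≤ 2 * q * (1 - Real.cos ((d + 3) * t)) :=
    mul_nonneg (by positivity) (by linarith)
  set w := 2 * q * (1 - Real.cos ((d + 3) * t))
  have h1 : (1 - q) * p * (1 - Real.cos (2 * t)) ≤ (p - q * p') * (1 - Real.cos (2 * t)) :=
    mul_le_mul_of_nonneg_right (by nlinarith) (by linarith)
  have h2 : p' * (4 / (d + 3) * (1 - q)) * (1 - Real.cos ((d + 1) * t)) ≤
      (p' - p' * rexp (-(4 * y))) * (1 - Real.cos ((d + 1) * t)) :=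
    mul_le_mul_of_nonneg_right (by linarith) (by linarith)
  have h3 := mul_le_mul_of_nonneg_left (add_le_add h1 h2) hs.le
  calc κ / ((d + 3) * y) ≤ κ / (1 - q) := by gcongr
    _ = κ * ((1 - q) ^ 2 + w) / ((1 - q) * ((1 - q) ^ 2 + w)) := by
      have : (1 - q) ^ 2 + w ≠ 0 := by positivity
      field_simp
    _ ≤ _ := by
      gcongr
      refine h.trans ?_
      linarith

theorem one_div_le_sin_two_pi_mul {m x : ℝ} (hm : 0 < m) (hx : 1 / (2 * m) ≤ x)
    (hx' : x ≤ 1 / 2 - 1 / (4 * m)) : 1 / m ≤ Real.sin (2 * π * x) := by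
  have hπ := Real.pi_pos
  have hx0 : 0 < x := lt_of_lt_of_le (by positivity) hx
  rw [div_le_iff₀ (by positivity)] at hx
  rcases le_or_gt x (1 / 4) with h | h
  · refine le_trans ?_ (Real.mul_le_sin (x := 2 * π * x) (by positivity) (by nlinarith))
    rw [show 2 / π * (2 * π * x) = 4 * x by field_simp; norm_num, div_le_iff₀ hm]
    linarith
  · have h' : 1 / (4 * m) ≤ 1 / 2 - x := by linarith
    have h0 : 0 < 1 / 2 - x := lt_of_lt_of_le (by positivity) h'
    rw [div_le_iff₀ (by positivity)] at h'
    rw [← Real.sin_pi_sub, show π - 2 * π * x = 2 * π * (1 / 2 - x) by ring]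
    refine le_trans ?_
      (Real.mul_le_sin (x := 2 * π * (1 / 2 - x)) (by positivity) (by nlinarith))
    rw [show 2 / π * (2 * π * (1 / 2 - x)) = 4 * (1 / 2 - x) by field_simp; ring,
      div_le_iff₀ hm]
    linarith

theorem cos_nonpos_of_even_of_near_half {d : ℕ} (hd : Even d) {x : ℝ}
    (hx : 1 / 2 - 1 / (4 * (d + 3)) ≤ x) (hx' : x ≤ 1 / 2) :
    Real.cos ((d + 1) * (2 * π * x)) ≤ 0 := by
  obtain ⟨k, hk⟩ := hd
  have hk' : (d : ℝ) = k + k := by exact_mod_cast hk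
  have e : ((d : ℝ) + 1) * (2 * π * x) = π - (d + 1) * (1 / 2 - x) * (2 * π) + k * (2 * π) := by
    rw [hk']; ring
  rw [e, Real.cos_add_nat_mul_two_pi, Real.cos_pi_sub, neg_nonpos]
  have hle : ((d : ℝ) + 1) * (1 / 2 - x) ≤ 1 / 4 := by
    calc ((d : ℝ) + 1) * (1 / 2 - x) ≤ (d + 3) * (1 / (4 * (d + 3))) :=
          mul_le_mul (by linarith) (by linarith) (by linarith) (by positivity)
      _ = 1 / 4 := by field_simp
  have h0 : 0 ≤ ((d : ℝ) + 1) * (1 / 2 - x) := mul_nonneg (by positivity) (by linarith)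
  have hπ := Real.pi_pos
  apply Real.cos_nonneg_of_mem_Icc
  constructor <;> nlinarith

/-- The uniform lower bound `exp (-mπ) / (m ^ 2 y)`, `m = d + 3`, for `0 ≤ x ≤ 1 / 2`. -/
theorem exp_neg_div_le_gFun_re_sub_gFun_re (d : ℕ) (hd : 4 ≤ d) (hde : Even d) {x y : ℝ}
    (hy : 0 < y) (hx0 : 0 ≤ x) (hx : x ≤ 1 / 2) (hxy : y < 2 * π * x) :
    rexp (-((d + 3) * π)) / (d + 3) / ((d + 3) * y) ≤
      (gFun d y).re - (gFun d (y + (2 * π * x : ℝ) * I)).re := by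
  have hd' : (4 : ℝ) ≤ d := by exact_mod_cast hd
  have hπ := Real.pi_gt_three
  have hπ' := Real.pi_lt_d2
  have hyπ : y ≤ π := by nlinarith
  refine div_le_gFun_re_sub_gFun_re d hd hy (by positivity) ?_
  have hA := Real.cos_le_one (2 * (2 * π * x))
  have hA' := Real.cos_le_one ((d + 1) * (2 * π * x))
  have hc := Real.cos_le_one ((d + 3) * (2 * π * x))
  have hp0 := Real.exp_pos (-(2 * y))
  have hp0' := Real.exp_pos (-((d + 1) * y))
  have hq0 := Real.exp_pos (-((d + 3) * y))
  have hw : 0 ≤ 2 * rexp (-((d + 3) * y)) * (1 - Real.cos ((d + 3) * (2 * π * x))) :=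
    mul_nonneg (by positivity) (by linarith)
  have hp : rexp (-(2 * π)) ≤ rexp (-(2 * y)) := by rw [Real.exp_le_exp]; linarith
  have hT : 0 ≤ rexp (-(2 * y)) * (1 - Real.cos (2 * (2 * π * x))) :=
    mul_nonneg hp0.le (by linarith)
  have hT' : 0 ≤ 4 / ((d : ℝ) + 3) * rexp (-((d + 1) * y)) *
      (1 - Real.cos ((d + 1) * (2 * π * x))) :=
    mul_nonneg (by positivity) (by linarith)
  have hκp : rexp (-((d + 3) * π)) / (d + 3) ≤ rexp (-(2 * y)) := by
    calc rexp (-((d + 3) * π)) / (d + 3) ≤ rexp (-((d + 3) * π)) :=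
          div_le_self (Real.exp_pos _).le (by linarith)
      _ ≤ rexp (-(2 * π)) := by rw [Real.exp_le_exp]; nlinarith
      _ ≤ _ := hp
  rcases le_or_gt x (1 / (2 * (d + 3))) with h1 | h1
  · have hmx : (d + 3) * x ≤ 1 / 2 := by
      calc (d + 3) * x ≤ (d + 3) * (1 / (2 * (d + 3))) := by gcongr
        _ = 1 / 2 := by field_simp
    have hmy : (d + 3) * y ≤ π := by nlinarith
    have hu : 8 * ((d + 3) * x) ^ 2 ≤ 1 - Real.cos ((d + 3) * (2 * π * x)) := by
      have h := Real.cos_le_one_sub_mul_cos_sq (x := (d + 3) * (2 * π * x)) (by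
        rw [abs_of_nonneg (by positivity)]; nlinarith)
      have e : 2 / π ^ 2 * ((d + 3) * (2 * π * x)) ^ 2 = 8 * ((d + 3) * x) ^ 2 := by
        field_simp; ring
      linarith
    have hqπ : rexp (-π) ≤ rexp (-((d + 3) * y)) := by rw [Real.exp_le_exp]; linarith
    have hs : (1 - rexp (-((d + 3) * y))) ^ 2 ≤ 40 * ((d + 3) * x) ^ 2 := by
      have hq1 : rexp (-((d + 3) * y)) ≤ 1 := by rw [Real.exp_le_one_iff]; simp; positivity
      have hsm : 1 - rexp (-((d + 3) * y)) ≤ (d + 3) * (2 * π * x) := by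
        have : ((d : ℝ) + 3) * y ≤ (d + 3) * (2 * π * x) := by gcongr
        linarith [Real.add_one_le_exp (-((d + 3) * y))]
      calc (1 - rexp (-((d + 3) * y))) ^ 2 ≤ ((d + 3) * (2 * π * x)) ^ 2 :=
            pow_le_pow_left₀ (by linarith) hsm 2
        _ = 4 * π ^ 2 * ((d + 3) * x) ^ 2 := by ring
        _ ≤ _ := by gcongr; nlinarith
    have hws : rexp (-π) * (1 - rexp (-((d + 3) * y))) ^ 2 ≤
        3 * (2 * rexp (-((d + 3) * y)) * (1 - Real.cos ((d + 3) * (2 * π * x)))) := by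
      calc rexp (-π) * (1 - rexp (-((d + 3) * y))) ^ 2 ≤
            rexp (-((d + 3) * y)) * (40 * ((d + 3) * x) ^ 2) := by gcongr
        _ ≤ rexp (-((d + 3) * y)) * (6 * (8 * ((d + 3) * x) ^ 2)) := by
            gcongr ?_ * ?_; nlinarith [sq_nonneg (((d : ℝ) + 3) * x)]
        _ ≤ rexp (-((d + 3) * y)) * (6 * (1 - Real.cos ((d + 3) * (2 * π * x)))) := by gcongr
        _ = _ := by ring
    have hκ : rexp (-((d + 3) * π)) / (d + 3) ≤ rexp (-(2 * y)) * rexp (-π) / 4 := by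
      calc rexp (-((d + 3) * π)) / (d + 3) ≤ rexp (-((d + 3) * π)) / 4 := by
            gcongr; linarith
        _ ≤ rexp (-(2 * π) + -π) / 4 := by gcongr; nlinarith
        _ ≤ _ := by rw [Real.exp_add]; gcongr
    have hπ1 : rexp (-π) ≤ 1 := by rw [Real.exp_le_one_iff]; linarith
    have hs0 : 0 ≤ (1 - rexp (-((d + 3) * y))) ^ 2 := sq_nonneg _
    generalize 2 * rexp (-((d + 3) * y)) * (1 - Real.cos ((d + 3) * (2 * π * x))) = w at *
    generalize (1 - rexp (-((d + 3) * y))) ^ 2 = s at *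
    calc rexp (-((d + 3) * π)) / (d + 3) * (s + w) ≤
          rexp (-(2 * y)) * rexp (-π) / 4 * (s + w) := by gcongr
      _ = rexp (-(2 * y)) / 4 * (rexp (-π) * s + rexp (-π) * w) := by ring
      _ ≤ rexp (-(2 * y)) / 4 * (3 * w + 1 * w) := by gcongr
      _ = w * rexp (-(2 * y)) + s * 0 := by ring
      _ ≤ _ := by gcongr <;> linarith
  · have hm : (0 : ℝ) < d + 3 := by linarith
    suffices h : rexp (-((d + 3) * π)) / (d + 3) ≤
        rexp (-(2 * y)) * (1 - Real.cos (2 * (2 * π * x))) +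
          4 / (d + 3) * rexp (-((d + 1) * y)) * (1 - Real.cos ((d + 1) * (2 * π * x))) by
      have h2 := mul_le_mul_of_nonneg_left h (sq_nonneg (1 - rexp (-((d + 3) * y))))
      have h3 := mul_le_mul_of_nonneg_left
        (hκp.trans (le_add_of_nonneg_right hp0'.le)) hw
      linarith
    rcases le_or_gt x (1 / 2 - 1 / (4 * (d + 3))) with h2 | h2
    · refine le_add_of_le_of_nonneg ?_ hT'
      have hsin : 1 / (d + 3) ≤ Real.sin (2 * π * x) :=
        one_div_le_sin_two_pi_mul hm h1.le h2
      have hA2 : 2 / ((d : ℝ) + 3) ^ 2 ≤ 1 - Real.cos (2 * (2 * π * x)) := by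
        rw [Real.cos_two_mul', Real.cos_sq']
        have := pow_le_pow_left₀ (by positivity) hsin 2
        rw [div_pow, one_pow] at this
        have e : 2 / ((d : ℝ) + 3) ^ 2 = 2 * (1 / (d + 3) ^ 2) := by ring
        linarith
      have hexp : (d : ℝ) + 3 ≤ rexp ((d + 1) * π) := by
        nlinarith [Real.add_one_le_exp ((d + 1) * π)]
      calc rexp (-((d + 3) * π)) / (d + 3) =
            rexp (-((d + 3) * π)) * (d + 3) / (d + 3) ^ 2 := by field_simp
        _ ≤ rexp (-((d + 3) * π)) * rexp ((d + 1) * π) / (d + 3) ^ 2 := by gcongr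
        _ = rexp (-(2 * π)) / (d + 3) ^ 2 := by rw [← Real.exp_add]; ring_nf
        _ ≤ rexp (-(2 * π)) * (2 / (d + 3) ^ 2) := by
          rw [div_eq_mul_inv]; gcongr; rw [div_eq_mul_inv]; linarith [inv_pos.2 (pow_pos hm 2)]
        _ ≤ _ := by gcongr
    · refine le_add_of_nonneg_of_le hT ?_
      have hcos : Real.cos ((d + 1) * (2 * π * x)) ≤ 0 :=
        cos_nonpos_of_even_of_near_half hde h2.le hx
      calc rexp (-((d + 3) * π)) / (d + 3) = 1 / (d + 3) * rexp (-((d + 3) * π)) * 1 := by ring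
        _ ≤ 4 / (d + 3) * rexp (-((d + 1) * y)) * (1 - Real.cos ((d + 1) * (2 * π * x))) := by
          gcongr
          · norm_num
          · nlinarith
          · linarith

/-- The first term of the minimum defining `c₂` is at most `exp (-mπ) / m ^ 2`, `m = d + 3`. -/
theorem two_pi_mul_one_sub_cos_mul_div_le {d : ℝ} (hd : 4 ≤ d) :
    2 * π * (1 - Real.cos (2 * π / (d + 5))) *
        (rexp ((2 * d + 4) * π) + rexp ((d + 5) * π)) /
        ((rexp ((d + 3) * π) - 1) * (rexp ((d + 3) * π) + 1) ^ 2) ≤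
      rexp (-((d + 3) * π)) / (d + 3) / (d + 3) := by
  have hπ := Real.pi_gt_three
  have hπ' := Real.pi_lt_d2
  have hQ : 2 ≤ rexp ((d + 3) * π) := by nlinarith [Real.add_one_le_exp ((d + 3) * π)]
  have hden : rexp ((d + 3) * π) ^ 3 ≤
      (rexp ((d + 3) * π) - 1) * (rexp ((d + 3) * π) + 1) ^ 2 := by
    nlinarith [sq_nonneg (rexp ((d + 3) * π))]
  have hcos : 1 - Real.cos (2 * π / (d + 5)) ≤ 2 * π ^ 2 / (d + 3) ^ 2 := by
    calc 1 - Real.cos (2 * π / (d + 5)) ≤ (2 * π / (d + 5)) ^ 2 / 2 := by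
          linarith [Real.one_sub_sq_div_two_le_cos (x := 2 * π / (d + 5))]
      _ ≤ (2 * π / (d + 3)) ^ 2 / 2 := by gcongr; linarith
      _ = _ := by rw [div_pow]; ring
  have hnum : rexp ((2 * d + 4) * π) + rexp ((d + 5) * π) ≤ 2 * rexp ((2 * d + 4) * π) := by
    have : rexp ((d + 5) * π) ≤ rexp ((2 * d + 4) * π) := by
      rw [Real.exp_le_exp]; nlinarith
    linarith
  have hexp : 8 * π ^ 3 ≤ rexp (2 * π) := by
    calc 8 * π ^ 3 ≤ 8 * 3.15 ^ 3 := by gcongr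
      _ ≤ 2.7 ^ 6 := by norm_num
      _ ≤ rexp 1 ^ 6 := by gcongr; linarith [Real.exp_one_gt_d9]
      _ = rexp 6 := by rw [← Real.exp_nat_mul]; norm_num
      _ ≤ _ := by rw [Real.exp_le_exp]; linarith
  calc _ ≤ 2 * π * (2 * π ^ 2 / (d + 3) ^ 2) * (2 * rexp ((2 * d + 4) * π)) /
        rexp ((d + 3) * π) ^ 3 := by
        gcongr
    _ = 8 * π ^ 3 * (rexp ((2 * d + 4) * π) / rexp ((d + 3) * π) ^ 3) / (d + 3) ^ 2 := by ring
    _ ≤ rexp (2 * π) * (rexp ((2 * d + 4) * π) / rexp ((d + 3) * π) ^ 3) / (d + 3) ^ 2 := by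
        gcongr
    _ = rexp (-((d + 3) * π)) / (d + 3) ^ 2 := by
        rw [← Real.exp_nat_mul, ← Real.exp_sub, ← Real.exp_add]; push_cast; ring_nf
    _ = _ := by rw [div_div, sq]

/-- For even d ≥ 4, y > 0 and |x| ≤ 1/2 with y < 2π|x|, we have
Re(g_d(y + 2πix)) − g_d(y) ≤ −c₂/y where c₂ = min(B1, B2, B3, B4). -/
theorem g_re_upper_bound (d : ℕ) (hd : 4 ≤ d) (hde : Even d) (x y : ℝ)
    (hy : 0 < y) (hx : |x| ≤ 1 / 2) (hxy : y < 2 * π * |x|) :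
    (gFun d ((y : ℂ) + 2 * (π : ℂ) * (x : ℂ) * Complex.I)).re -
        (gFun d (y : ℂ)).re ≤
      -(min (min
          (2 * π * (1 - Real.cos (2 * π / ((d : ℝ) + 5))) *
            (Real.exp ((2 * (d : ℝ) + 4) * π) + Real.exp (((d : ℝ) + 5) * π)) /
            ((Real.exp (((d : ℝ) + 3) * π) - 1) *
              (Real.exp (((d : ℝ) + 3) * π) + 1) ^ 2))
          (π * (1 - Real.cos (2 * π / ((d : ℝ) + 5))) *
            (Real.exp ((3 * (d : ℝ) + 7) * π) + Real.exp (2 * π) -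
              Real.exp ((2 * (d : ℝ) + 4) * π) - Real.exp (((d : ℝ) + 5) * π)) /
            ((Real.exp (((d : ℝ) + 3) * π) - 1) *
              (Real.exp (((d : ℝ) + 3) * π) + 1) ^ 2)))
        (min
          (2 * π * (1 - Real.cos (((d : ℝ) + 3 - π) / ((d : ℝ) + 3) ^ 2)) *
            ((d : ℝ) + 3) * ((d : ℝ) + 1) /
            ((Real.exp (π * ((d : ℝ) + 3)) - 1) * (8 * π ^ 2 + ((d : ℝ) + 3) ^ 2)))
          (8 * π /
            ((Real.exp (((d : ℝ) + 3) * π) - 1) *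
              ((Real.exp (((d : ℝ) + 3) / 2) - 1) ^ 2 +
                4 * Real.exp (((d : ℝ) + 3) / 2)))))) / y := by
  have hd' : (4 : ℝ) ≤ d := by exact_mod_cast hd
  have habs : (gFun d ((y : ℂ) + 2 * (π : ℂ) * (x : ℂ) * Complex.I)).re =
      (gFun d (y + (2 * π * |x| : ℝ) * I)).re := by
    have h1 := gFun_re_sub_gFun_re d hd hy (2 * π * x)
    have h2 := gFun_re_sub_gFun_re d hd hy (2 * π * |x|)
    have hcos : ∀ c : ℝ, Real.cos (c * (2 * π * |x|)) = Real.cos (c * (2 * π * x)) := fun c => by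
      rcases abs_choice x with h | h <;> rw [h]
      rw [← Real.cos_neg]; ring_nf
    rw [hcos, hcos, hcos, ← h1] at h2
    push_cast at h2 ⊢
    linarith
  have h := exp_neg_div_le_gFun_re_sub_gFun_re d hd hde hy (abs_nonneg x) hx hxy
  rw [← div_div] at h
  rw [habs, neg_div, ← neg_sub, neg_le_neg_iff]
  refine le_trans ?_ h
  gcongr
  exact (min_le_left _ _).trans ((min_le_left _ _).trans (two_pi_mul_one_sub_cos_mul_div_le hd'))
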